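/- arXiv:2006.03438 — 3 statements merged into one kernel-verified Lean document; each statement's English description precedes it below -/
import Mathlib

section
/- Let O be a fluctuation set with fluctuation interval [a, b], where a, b ∈ {1, …, n−1}. Then for every x ∈ O with nC(x) = a, the maximum M(x) at k = a among the lines active at x is attained by an active cooperative line and by no active defective line; and for every x ∈ O with nC(x) = b, the maximum M(x) at k = b among the lines active at x is attained by an active defective line and by no active cooperative line. -/
/-- A finite well-mixed population with `m ≥ 1` types: type `i` consists of
`nvec i ≥ 1` identical agents with real payoff entries `R i, S i, T i, P i`. -/
structure Pop (m : ℕ) where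
  hm : 0 < m
  nvec : Fin m → ℕ
  hnvec : ∀ i, 1 ≤ nvec i
  R : Fin m → ℝ
  S : Fin m → ℝ
  T : Fin m → ℝ
  P : Fin m → ℝ

variable {m : ℕ}

/-- The total number `n` of agents. -/
def nTot (pop : Pop m) : ℕ := ∑ i, pop.nvec i

/-- Cooperative line of type `i`:  `u_i^C(k) = (R_i - S_i)·k + S_i·n`. -/
noncomputable def uC (pop : Pop m) (i : Fin m) (k : ℝ) : ℝ :=
  (pop.R i - pop.S i) * k + pop.S i * (nTot pop : ℝ)

/-- Defective line of type `i`:  `u_i^D(k) = (T_i - P_i)·k + P_i·n`. -/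
noncomputable def uD (pop : Pop m) (i : Fin m) (k : ℝ) : ℝ :=
  (pop.T i - pop.P i) * k + pop.P i * (nTot pop : ℝ)

/-- A state: `x i` cooperators of type `i`, with `x i ≤ nvec i`. -/
def IsState (pop : Pop m) (x : Fin m → ℕ) : Prop := ∀ i, x i ≤ pop.nvec i

/-- The total number of cooperators at state `x`. -/
def nC (x : Fin m → ℕ) : ℕ := ∑ i, x i

/-- The cooperative line of type `i` is active at `x`. -/
def activeC (x : Fin m → ℕ) (i : Fin m) : Prop := 0 < x i

/-- The defective line of type `i` is active at `x`. -/
def activeD (pop : Pop m) (x : Fin m → ℕ) (i : Fin m) : Prop := x i < pop.nvec i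

/-- `v` bounds from above the values, at `k = nC x`, of all lines active at `x`;
the value of an active line satisfying this attains the maximum `M(x)`. -/
def ubActive (pop : Pop m) (x : Fin m → ℕ) (v : ℝ) : Prop :=
  (∀ i, activeC x i → uC pop i (nC x) ≤ v) ∧
  (∀ i, activeD pop x i → uD pop i (nC x) ≤ v)

/-- Some active cooperative line attains the maximum `M(x)` over active lines. -/
def coopMax (pop : Pop m) (x : Fin m → ℕ) : Prop :=
  ∃ i, activeC x i ∧ ubActive pop x (uC pop i (nC x))

/-- Some active defective line attains the maximum `M(x)` over active lines. -/
def defMax (pop : Pop m) (x : Fin m → ℕ) : Prop :=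
  ∃ i, activeD pop x i ∧ ubActive pop x (uD pop i (nC x))

/-- One-step successor relation of the asynchronous imitation dynamics: one agent
is activated; an activated cooperator of type `i` switches (to `x - e_i`) exactly
when no active cooperative line attains `M(x)`, an activated defector of type `i`
switches (to `x + e_i`) exactly when no active defective line attains `M(x)`;
otherwise the state is unchanged. -/
def Step (pop : Pop m) (x y : Fin m → ℕ) : Prop :=
  (∃ i, activeC x i ∧
    ((coopMax pop x ∧ y = x) ∨
     (¬ coopMax pop x ∧ y = Function.update x i (x i - 1)))) ∨
  (∃ i, activeD pop x i ∧
    ((defMax pop x ∧ y = x) ∨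
     (¬ defMax pop x ∧ y = Function.update x i (x i + 1))))

/-- A trajectory of the dynamics. -/
def Traj (pop : Pop m) (X : ℕ → Fin m → ℕ) : Prop :=
  IsState pop (X 0) ∧ ∀ t, Step pop (X t) (X (t + 1))

/-- An equilibrium state: its only one-step successor is itself. -/
def IsEquilibrium (pop : Pop m) (x : Fin m → ℕ) : Prop :=
  IsState pop x ∧ ∀ y, Step pop x y → y = x

/-- A positively invariant set of states. -/
def PosInv (pop : Pop m) (Q : Set (Fin m → ℕ)) : Prop :=
  (∀ x ∈ Q, IsState pop x) ∧ ∀ x ∈ Q, ∀ y, Step pop x y → y ∈ Q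

/-- A minimal positively invariant set: no nonempty proper subset is positively
invariant. -/
def MinPosInv (pop : Pop m) (Q : Set (Fin m → ℕ)) : Prop :=
  PosInv pop Q ∧ ∀ Q' : Set (Fin m → ℕ), Q' ⊂ Q → Q'.Nonempty → ¬ PosInv pop Q'

/-- A fluctuation set: a minimal positively invariant set with more than one state. -/
def FluctSet (pop : Pop m) (O : Set (Fin m → ℕ)) : Prop :=
  MinPosInv pop O ∧ ∃ x ∈ O, ∃ y ∈ O, x ≠ y

/-- `[a, b]` is the fluctuation interval of the fluctuation set `O`:
`a = min {nC x : x ∈ O}` and `b = max {nC x : x ∈ O}`. -/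
def FluctInterval (pop : Pop m) (O : Set (Fin m → ℕ)) (a b : ℕ) : Prop :=
  FluctSet pop O ∧
  (∃ x ∈ O, nC x = a) ∧ (∀ x ∈ O, a ≤ nC x) ∧
  (∃ x ∈ O, nC x = b) ∧ (∀ x ∈ O, nC x ≤ b)

/-- An intersection point of `u_i^C` and `u_j^D`: a value `k ∈ [1, n-1]` with
`u_i^C(k) = u_j^D(k)`. -/
def IsInterPt (pop : Pop m) (i j : Fin m) (k : ℝ) : Prop :=
  1 ≤ k ∧ k ≤ (nTot pop : ℝ) - 1 ∧ uC pop i k = uD pop j k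

/-- Potentially attracting: `u_i^C(k - 1) > u_j^D(k - 1)`. -/
def PotAttract (pop : Pop m) (i j : Fin m) (k : ℝ) : Prop :=
  uD pop j (k - 1) < uC pop i (k - 1)

/-- A fluctuation point: a non-integer potentially attracting intersection point
`p_ij` with value `k` such that there are a state `x` with `nC x = ⌊k⌋` at which
`u_i^C` is active and attains the maximum among the lines active at `x`, and a
state obtained from `x` by increasing exactly one coordinate by `1` at which
`u_j^D` is active and attains the maximum among the active lines. -/
def IsFluctPt (pop : Pop m) (i j : Fin m) (k : ℝ) : Prop :=
  IsInterPt pop i j k ∧ PotAttract pop i j k ∧ (∀ z : ℤ, (z : ℝ) ≠ k) ∧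
  ∃ x, IsState pop x ∧ ((nC x : ℤ) = ⌊k⌋) ∧
    activeC x i ∧ ubActive pop x (uC pop i (nC x)) ∧
    ∃ l, IsState pop (Function.update x l (x l + 1)) ∧
      activeD pop (Function.update x l (x l + 1)) j ∧
      ubActive pop (Function.update x l (x l + 1))
        (uD pop j (nC (Function.update x l (x l + 1))))

/-- `[lo, hi]` contains the value of a fluctuation point. -/
def HasFluctPtIn (pop : Pop m) (lo hi : ℝ) : Prop :=
  ∃ i j : Fin m, ∃ k : ℝ, IsFluctPt pop i j k ∧ lo ≤ k ∧ k ≤ hi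

/-- `[a, a+1]` is a left wall: every trajectory starting with at least `a + 1`
cooperators always has at least `a` cooperators. -/
def LeftWall (pop : Pop m) (a : ℕ) : Prop :=
  ∀ X : ℕ → Fin m → ℕ, Traj pop X → a + 1 ≤ nC (X 0) → ∀ t, a ≤ nC (X t)

/-- `[b-1, b]` is a right wall: every trajectory starting with at most `b - 1`
cooperators always has at most `b` cooperators. -/
def RightWall (pop : Pop m) (b : ℕ) : Prop :=
  ∀ X : ℕ → Fin m → ℕ, Traj pop X → nC (X 0) ≤ b - 1 → ∀ t, nC (X t) ≤ b

/-- The 1-norm distance between two states. -/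
def dist1 (x y : Fin m → ℕ) : ℕ := ∑ i, ((x i : ℤ) - (y i : ℤ)).natAbs

/-- Lyapunov stability of an equilibrium state `s`. -/
def Stable (pop : Pop m) (s : Fin m → ℕ) : Prop :=
  ∀ ε : ℕ, 2 ≤ ε → ∃ δ : ℕ, 2 ≤ δ ∧
    ∀ X : ℕ → Fin m → ℕ, Traj pop X → dist1 (X 0) s < δ → ∀ t, dist1 (X t) s < ε

theorem aux_eq (pop : Pop m) (O : Set (Fin m → ℕ)) (hO : FluctSet pop O)
    (x : Fin m → ℕ) (hx : x ∈ O) (hc : coopMax pop x) (hd : defMax pop x) : False := by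
  obtain ⟨⟨⟨hs, _⟩, hmin⟩, y, hy, z, hz, hyz⟩ := hO
  refine hmin {x} ?_ ⟨x, rfl⟩ ⟨?_, ?_⟩
  · refine ⟨by simpa using hx, fun h => hyz ?_⟩
    have h1 : y = x := h hy
    have h2 : z = x := h hz
    rw [h1, h2]
  · intro w hw
    have h1 : w = x := hw
    exact h1 ▸ hs x hx
  · intro w hw v hv
    have h1 : w = x := hw
    subst h1
    rcases hv with ⟨i, _, h | h⟩ | ⟨i, _, h | h⟩
    · exact h.2
    · exact absurd hc h.1
    · exact h.2
    · exact absurd hd h.1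

theorem aux_upd (x : Fin m → ℕ) (i : Fin m) (v : ℕ) :
    nC (Function.update x i v) + x i = nC x + v := by
  unfold nC
  rw [Finset.sum_update_of_mem (Finset.mem_univ i),
    ← Finset.add_sum_erase Finset.univ x (Finset.mem_univ i), Finset.sdiff_singleton_eq_erase]
  omega

/-- at the endpoints of a fluctuation interval, the maximum among
the active lines is attained by an active cooperative (resp. defective) line and
by no active defective (resp. cooperative) line. -/
theorem stmt1 (pop : Pop m) (O : Set (Fin m → ℕ)) (a b : ℕ)
    (ha : 1 ≤ a) (ha' : a ≤ nTot pop - 1) (hb : 1 ≤ b) (hb' : b ≤ nTot pop - 1)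
    (hO : FluctInterval pop O a b) :
    (∀ x ∈ O, nC x = a → coopMax pop x ∧ ¬ defMax pop x) ∧
    (∀ x ∈ O, nC x = b → defMax pop x ∧ ¬ coopMax pop x) := by
  have hF := hO.1
  obtain ⟨-, -, hmin, -, hmax⟩ := hO
  constructor
  · intro x hx hxa
    have hc : coopMax pop x := by
      by_contra hc
      have : ∃ i, 0 < x i := by
        by_contra h
        push Not at h
        have h0 : nC x = 0 := Finset.sum_eq_zero fun i _ => Nat.le_zero.mp (h i)
        omega
      obtain ⟨i, hi⟩ := this
      have hm := hmin _ (hF.1.1.2 x hx _ (Or.inl ⟨i, hi, Or.inr ⟨hc, rfl⟩⟩))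
      have hu := aux_upd x i (x i - 1)
      omega
    exact ⟨hc, fun hd => aux_eq pop O hF x hx hc hd⟩
  · intro x hx hxb
    have hd : defMax pop x := by
      by_contra hd
      have : ∃ i, x i < pop.nvec i := by
        by_contra h
        push Not at h
        have h0 : nTot pop ≤ nC x := Finset.sum_le_sum fun i _ => h i
        omega
      obtain ⟨i, hi⟩ := this
      have hm := hmax _ (hF.1.1.2 x hx _ (Or.inr ⟨i, hi, Or.inr ⟨hd, rfl⟩⟩))
      have hu := aux_upd x i (x i + 1)
      omega
    exact ⟨hd, fun hc => aux_eq pop O hF x hx hc hd⟩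
end

section
/- If [a, b], with a, b ∈ {1, …, n−1}, is the fluctuation interval of some fluctuation set, then there exists a fluctuation point whose value lies in the open interval (a, a+1) and there exists a fluctuation point whose value lies in the open interval (b−1, b). -/
variable {m : ℕ}

theorem aux_max (pop : Pop m) (x : Fin m → ℕ) : coopMax pop x ∨ defMax pop x := by
  classical
  let f : Fin m ⊕ Fin m → ℝ := Sum.elim (fun i => uC pop i (nC x)) (fun i => uD pop i (nC x))
  let A : Fin m ⊕ Fin m → Prop := Sum.elim (fun i => activeC x i) (fun i => activeD pop x i)
  have hne : (Finset.univ.filter A).Nonempty := by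
    by_cases h : 0 < x ⟨0, pop.hm⟩
    · exact ⟨Sum.inl ⟨0, pop.hm⟩, Finset.mem_filter.mpr ⟨Finset.mem_univ _, h⟩⟩
    · refine ⟨Sum.inr ⟨0, pop.hm⟩, ?_⟩
      have := pop.hnvec ⟨0, pop.hm⟩
      refine Finset.mem_filter.mpr ⟨Finset.mem_univ _, ?_⟩
      change x ⟨0, pop.hm⟩ < pop.nvec ⟨0, pop.hm⟩
      omega
  obtain ⟨s, hs, hmax⟩ := Finset.exists_max_image _ f hne
  have hub : ubActive pop x (f s) :=
    ⟨fun i hi => hmax (Sum.inl i) (Finset.mem_filter.mpr ⟨Finset.mem_univ _, hi⟩),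
     fun i hi => hmax (Sum.inr i) (Finset.mem_filter.mpr ⟨Finset.mem_univ _, hi⟩)⟩
  have hA : A s := (Finset.mem_filter.mp hs).2
  rcases s with i | i
  · exact Or.inl ⟨i, hA, hub⟩
  · exact Or.inr ⟨i, hA, hub⟩

theorem aux_nC_up (x : Fin m → ℕ) (l : Fin m) :
    nC (Function.update x l (x l + 1)) = nC x + 1 := by
  unfold nC
  rw [Finset.sum_update_of_mem (Finset.mem_univ l)]
  have := Finset.sum_update_of_mem (Finset.mem_univ l) x (x l)
  rw [Function.update_eq_self] at this
  omega

theorem aux_down_up (x : Fin m → ℕ) (l : Fin m) (h : 0 < x l) :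
    Function.update (Function.update x l (x l - 1)) l
      (Function.update x l (x l - 1) l + 1) = x := by
  rw [Function.update_self, Function.update_idem]
  rw [show x l - 1 + 1 = x l by omega, Function.update_eq_self]

theorem aux_nC_down (x : Fin m → ℕ) (l : Fin m) (h : 0 < x l) :
    nC (Function.update x l (x l - 1)) + 1 = nC x := by
  rw [← aux_nC_up _ l, aux_down_up x l h]

theorem aux_strict (pop : Pop m) (x : Fin m → ℕ) (hD : ¬ defMax pop x) (i : Fin m)
    (hi : ubActive pop x (uC pop i (nC x))) (j : Fin m) (hj : activeD pop x j) :
    uD pop j (nC x) < uC pop i (nC x) := by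
  refine lt_of_le_of_ne (hi.2 j hj) fun h => hD ⟨j, hj, ?_⟩
  rw [h]; exact hi

theorem aux_strict2 (pop : Pop m) (x : Fin m → ℕ) (hC : ¬ coopMax pop x) (j : Fin m)
    (hj : ubActive pop x (uD pop j (nC x))) (i : Fin m) (hi : activeC x i) :
    uC pop i (nC x) < uD pop j (nC x) := by
  refine lt_of_le_of_ne (hj.1 i hi) fun h => hC ⟨i, hi, ?_⟩
  rw [h]; exact hj

theorem aux_fluct (pop : Pop m) (x : Fin m → ℕ) (l : Fin m) (hx : IsState pop x)
    (hy : IsState pop (Function.update x l (x l + 1)))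
    (hD : ¬ defMax pop x) (hC : ¬ coopMax pop (Function.update x l (x l + 1))) :
    ∃ i j : Fin m, ∃ k : ℝ, IsFluctPt pop i j k ∧ (nC x : ℝ) < k ∧ k < (nC x : ℝ) + 1 := by
  obtain ⟨i, hi, hiu⟩ := (aux_max pop x).resolve_right hD
  obtain ⟨j, hj, hju⟩ := (aux_max pop (Function.update x l (x l + 1))).resolve_left hC
  have hle : ∀ t, x t ≤ Function.update x l (x l + 1) t := by
    intro t
    by_cases h : t = l
    · subst h; simp
    · simp [h]
  have hiy : activeC (Function.update x l (x l + 1)) i := lt_of_lt_of_le hi (hle i)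
  have hjx : activeD pop x j := lt_of_le_of_lt (hle j) hj
  have h1 := aux_strict pop x hD i hiu j hjx
  have h2 := aux_strict2 pop _ hC j hju i hiy
  have hn1 : 1 ≤ nC x := by
    have := Finset.single_le_sum (f := x) (fun t _ => Nat.zero_le _) (Finset.mem_univ i)
    unfold nC
    unfold activeC at hi
    omega
  have hn2 : nC x + 1 < nTot pop := by
    rw [← aux_nC_up x l]
    exact Finset.sum_lt_sum (fun t _ => hy t) ⟨j, Finset.mem_univ j, hj⟩
  have hn1' : (1 : ℝ) ≤ nC x := by exact_mod_cast hn1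
  have hn2' : (nC x : ℝ) + 1 + 1 ≤ nTot pop := by exact_mod_cast hn2
  rw [aux_nC_up] at h2
  push_cast at h2
  set N : ℝ := (nC x : ℝ) with hN
  let A : ℝ := (pop.R i - pop.S i) - (pop.T j - pop.P j)
  let B : ℝ := (pop.S i - pop.P j) * (nTot pop : ℝ)
  have hAB : ∀ k, uC pop i k - uD pop j k = A * k + B := by
    intro k; simp only [uC, uD, A, B]; ring
  have e1 := hAB N
  have e2 := hAB (N + 1)
  have hA : A < 0 := by nlinarith
  have hk0 : A * (-B / A) + B = 0 := by rw [mul_div_cancel₀ _ hA.ne]; ring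
  have hk1 : N < -B / A := by
    by_contra h
    push Not at h
    nlinarith
  have hk2 : -B / A < N + 1 := by
    by_contra h
    push Not at h
    nlinarith
  generalize -B / A = k at hk0 hk1 hk2
  have e3 := hAB k
  have e4 := hAB (k - 1)
  have hfl : (nC x : ℤ) = ⌊k⌋ := by
    symm
    rw [Int.floor_eq_iff]
    push_cast
    exact ⟨hk1.le, hk2⟩
  refine ⟨i, j, k, ⟨⟨by linarith, by linarith, by linarith⟩, ?_, ?_, x, hx, hfl, hi, hiu,
    l, hy, hj, hju⟩, hk1, hk2⟩
  · unfold PotAttract; nlinarith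
  · intro z hz
    rw [← hz, Int.floor_intCast] at hfl
    rw [← hz, ← hfl] at hk1
    push_cast at hk1
    linarith

theorem aux_not_eq (pop : Pop m) (O : Set (Fin m → ℕ)) (hO : FluctSet pop O)
    (x : Fin m → ℕ) (hx : x ∈ O) : ¬ (coopMax pop x ∧ defMax pop x) := by
  rintro ⟨hc, hd⟩
  obtain ⟨⟨hinv, hmin⟩, u, hu, v, hv, huv⟩ := hO
  refine hmin {x} ⟨by simpa using hx, fun h => huv ?_⟩ ⟨x, rfl⟩ ⟨?_, ?_⟩
  · have h1 := h hu
    have h2 := h hv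
    simp only [Set.mem_singleton_iff] at h1 h2
    rw [h1, h2]
  · rintro z rfl; exact hinv.1 z hx
  · rintro z rfl y (⟨i, _, ⟨_, h⟩ | ⟨h, _⟩⟩ | ⟨i, _, ⟨_, h⟩ | ⟨h, _⟩⟩)
    · exact h
    · exact absurd hc h
    · exact h
    · exact absurd hd h

/-- each end interval of a fluctuation interval contains a
fluctuation point in its interior. -/
theorem stmt3 (pop : Pop m) (O : Set (Fin m → ℕ)) (a b : ℕ)
    (ha : 1 ≤ a) (ha' : a ≤ nTot pop - 1) (hb : 1 ≤ b) (hb' : b ≤ nTot pop - 1)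
    (hO : FluctInterval pop O a b) :
    (∃ i j : Fin m, ∃ k : ℝ, IsFluctPt pop i j k ∧ (a : ℝ) < k ∧ k < (a : ℝ) + 1) ∧
    (∃ i j : Fin m, ∃ k : ℝ, IsFluctPt pop i j k ∧ (b : ℝ) - 1 < k ∧ k < (b : ℝ)) := by
  obtain ⟨hF, ⟨xa, hxa, hna⟩, hamin, ⟨xb, hxb, hnb⟩, hbmax⟩ := hO
  have hne := aux_not_eq pop O hF
  obtain ⟨⟨⟨hst, hinv⟩, hmin⟩, -⟩ := hF
  have exC : ∀ x : Fin m → ℕ, 1 ≤ nC x → ∃ i, activeC x i := by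
    intro x h
    by_contra hc
    push Not at hc
    have : nC x = 0 := Finset.sum_eq_zero fun i _ => by
      have := hc i; unfold activeC at this; omega
    omega
  have exD : ∀ x : Fin m → ℕ, nC x < nTot pop → ∃ i, activeD pop x i := by
    intro x h
    obtain ⟨i, _, hi⟩ := Finset.exists_lt_of_sum_lt (s := Finset.univ) h
    exact ⟨i, hi⟩
  -- behaviour at the bottom level
  have botD : ∀ x ∈ O, nC x = a → ¬ defMax pop x := by
    intro x hx hn hd
    by_cases hc : coopMax pop x
    · exact hne x hx ⟨hc, hd⟩
    · obtain ⟨i, hi⟩ := exC x (by omega)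
      have h1 := hamin _ (hinv x hx _ (Or.inl ⟨i, hi, Or.inr ⟨hc, rfl⟩⟩))
      have h2 := aux_nC_down x i hi
      omega
  have topC : ∀ x ∈ O, nC x = b → ¬ coopMax pop x := by
    intro x hx hn hc
    by_cases hd : defMax pop x
    · exact hne x hx ⟨hc, hd⟩
    · obtain ⟨i, hi⟩ := exD x (by omega)
      have h1 := hbmax _ (hinv x hx _ (Or.inr ⟨i, hi, Or.inr ⟨hd, rfl⟩⟩))
      have h2 := aux_nC_up x i
      omega
  constructor
  · have key : ¬ PosInv pop {z | z ∈ O ∧ a < nC z} := by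
      refine hmin _ ⟨fun z hz => hz.1, fun h => ?_⟩ ?_
      · have := (h hxa).2; omega
      · obtain ⟨i, hi⟩ := exD xa (by omega)
        refine ⟨Function.update xa i (xa i + 1),
          hinv xa hxa _ (Or.inr ⟨i, hi, Or.inr ⟨botD xa hxa hna, rfl⟩⟩), ?_⟩
        rw [aux_nC_up]; omega
    have key2 : ∃ z ∈ O, ∃ w, a < nC z ∧ Step pop z w ∧ nC w ≤ a := by
      by_contra hcon
      push Not at hcon
      exact key ⟨fun z hz => hst z hz.1, fun z hz w hw =>
        ⟨hinv z hz.1 w hw, hcon z hz.1 w hz.2 hw⟩⟩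
    obtain ⟨z, hz, w, haz, hs, hw⟩ := key2
    have hwO := hinv z hz w hs
    have hwa : nC w = a := le_antisymm hw (hamin w hwO)
    rcases hs with ⟨i, hi, ⟨_, h⟩ | ⟨hc, h⟩⟩ | ⟨i, hi, ⟨_, h⟩ | ⟨hc, h⟩⟩
    · subst h; omega
    · have hzw : Function.update w i (w i + 1) = z := by
        rw [h]; exact aux_down_up z i hi
      have := aux_fluct pop w i (hst w hwO) (by rw [hzw]; exact hst z hz)
        (botD w hwO hwa) (by rw [hzw]; exact hc)
      rwa [hwa] at this
    · subst h; omega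
    · rw [h, aux_nC_up] at hw; omega
  · have key : ¬ PosInv pop {z | z ∈ O ∧ nC z < b} := by
      refine hmin _ ⟨fun z hz => hz.1, fun h => ?_⟩ ?_
      · have := (h hxb).2; omega
      · obtain ⟨i, hi⟩ := exC xb (by omega)
        refine ⟨Function.update xb i (xb i - 1),
          hinv xb hxb _ (Or.inl ⟨i, hi, Or.inr ⟨topC xb hxb hnb, rfl⟩⟩), ?_⟩
        have := aux_nC_down xb i hi
        omega
    have key2 : ∃ z ∈ O, ∃ w, nC z < b ∧ Step pop z w ∧ b ≤ nC w := by
      by_contra hcon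
      push Not at hcon
      exact key ⟨fun z hz => hst z hz.1, fun z hz w hw =>
        ⟨hinv z hz.1 w hw, hcon z hz.1 w hz.2 hw⟩⟩
    obtain ⟨z, hz, w, hbz, hs, hw⟩ := key2
    have hwO := hinv z hz w hs
    have hwb : nC w = b := le_antisymm (hbmax w hwO) hw
    rcases hs with ⟨i, hi, ⟨_, h⟩ | ⟨hc, h⟩⟩ | ⟨i, hi, ⟨_, h⟩ | ⟨hd, h⟩⟩
    · subst h; omega
    · have := aux_nC_down z i hi
      rw [← h] at this; omega
    · subst h; omega
    · have hn := aux_nC_up z i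
      rw [← h, hwb] at hn
      obtain ⟨p, q, k, hk, h1, h2⟩ := aux_fluct pop z i (hst z hz)
        (by rw [← h]; exact hst w hwO) hd (by rw [← h]; exact topC w hwO hwb)
      have hn' : (b : ℝ) = nC z + 1 := by exact_mod_cast hn
      exact ⟨p, q, k, hk, by linarith, by linarith⟩
end

section
/- If [a, b], with a, b ∈ {1, …, n−1}, is the fluctuation interval of some fluctuation set, then every trajectory whose initial state x(0) satisfies nC(x(0)) ∈ [a+1, b−1] satisfies nC(x(t)) ∈ [a, b] for all t ≥ 0. -/
variable {m : ℕ}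

lemma nC_succ (x : Fin m → ℕ) (i : Fin m) :
    nC (Function.update x i (x i + 1)) = nC x + 1 := by
  unfold nC
  rw [Finset.sum_update_of_mem (Finset.mem_univ i)]
  rw [Finset.sum_eq_add_sum_sdiff_singleton_of_mem (Finset.mem_univ i) x]
  omega

lemma nC_pred (x : Fin m → ℕ) (i : Fin m) (h : 0 < x i) :
    nC (Function.update x i (x i - 1)) + 1 = nC x := by
  unfold nC
  rw [Finset.sum_update_of_mem (Finset.mem_univ i)]
  rw [Finset.sum_eq_add_sum_sdiff_singleton_of_mem (Finset.mem_univ i) x]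
  omega

lemma eq_of_le_nC (x y : Fin m → ℕ) (h : ∀ i, x i ≤ y i) (hs : nC x = nC y) : x = y := by
  funext i
  exact (Finset.sum_eq_sum_iff_of_le (fun i _ => h i)).1 hs i (Finset.mem_univ i)

lemma ex_lt (x y : Fin m → ℕ) (hs : nC x = nC y) (hne : x ≠ y) : ∃ i, x i < y i := by
  by_contra hc
  push Not at hc
  exact hne (eq_of_le_nC y x hc hs.symm).symm

lemma not_coop (pop : Pop m) (x : Fin m → ℕ) (h : ¬ coopMax pop x) :
    ∃ j, activeD pop x j ∧ ∀ i, activeC x i → uC pop i (nC x) < uD pop j (nC x) := by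
  classical
  by_cases hne : (Finset.univ.filter (fun i => activeC x i)).Nonempty
  · obtain ⟨i, hi, hmax⟩ := Finset.exists_max_image _ (fun i => uC pop i (nC x)) hne
    simp only [Finset.mem_filter, Finset.mem_univ, true_and] at hi hmax
    by_contra hc
    push Not at hc
    refine h ⟨i, hi, hmax, fun j hj => ?_⟩
    obtain ⟨i', hi', hle⟩ := hc j hj
    exact hle.trans (hmax i' hi')
  · rw [Finset.not_nonempty_iff_eq_empty, Finset.filter_eq_empty_iff] at hne
    refine ⟨⟨0, pop.hm⟩, ?_, fun i hi => absurd hi (hne (Finset.mem_univ i))⟩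
    have h1 := @hne ⟨0, pop.hm⟩ (Finset.mem_univ _)
    have h2 := pop.hnvec ⟨0, pop.hm⟩
    unfold activeC at h1
    unfold activeD
    omega

lemma not_def (pop : Pop m) (x : Fin m → ℕ) (h : ¬ defMax pop x) :
    ∃ j, activeC x j ∧ ∀ i, activeD pop x i → uD pop i (nC x) < uC pop j (nC x) := by
  classical
  by_cases hne : (Finset.univ.filter (fun i => activeD pop x i)).Nonempty
  · obtain ⟨i, hi, hmax⟩ := Finset.exists_max_image _ (fun i => uD pop i (nC x)) hne
    simp only [Finset.mem_filter, Finset.mem_univ, true_and] at hi hmax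
    by_contra hc
    push Not at hc
    refine h ⟨i, hi, fun j hj => ?_, hmax⟩
    obtain ⟨i', hi', hle⟩ := hc j hj
    exact hle.trans (hmax i' hi')
  · rw [Finset.not_nonempty_iff_eq_empty, Finset.filter_eq_empty_iff] at hne
    refine ⟨⟨0, pop.hm⟩, ?_, fun i hi => absurd hi (hne (Finset.mem_univ i))⟩
    have h1 := @hne ⟨0, pop.hm⟩ (Finset.mem_univ _)
    have h2 := pop.hnvec ⟨0, pop.hm⟩
    unfold activeD at h1
    unfold activeC
    omega

lemma step_cases (pop : Pop m) (x y : Fin m → ℕ) (h : Step pop x y) :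
    y = x ∨ (¬ coopMax pop x ∧ ∃ i, 0 < x i ∧ y = Function.update x i (x i - 1)
        ∧ nC y + 1 = nC x) ∨
      (¬ defMax pop x ∧ ∃ i, x i < pop.nvec i ∧ y = Function.update x i (x i + 1)
        ∧ nC y = nC x + 1) := by
  rcases h with ⟨i, hi, ⟨_, rfl⟩ | ⟨h1, rfl⟩⟩ | ⟨i, hi, ⟨_, rfl⟩ | ⟨h1, rfl⟩⟩
  · exact Or.inl rfl
  · exact Or.inr (Or.inl ⟨h1, i, hi, rfl, nC_pred x i hi⟩)
  · exact Or.inl rfl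
  · exact Or.inr (Or.inr ⟨h1, i, hi, rfl, nC_succ x i⟩)

lemma step_down (pop : Pop m) (x : Fin m → ℕ) (h : ¬ coopMax pop x) (i : Fin m) (hi : 0 < x i) :
    Step pop x (Function.update x i (x i - 1)) := Or.inl ⟨i, hi, Or.inr ⟨h, rfl⟩⟩

lemma step_up (pop : Pop m) (x : Fin m → ℕ) (h : ¬ defMax pop x) (i : Fin m)
    (hi : x i < pop.nvec i) :
    Step pop x (Function.update x i (x i + 1)) := Or.inr ⟨i, hi, Or.inr ⟨h, rfl⟩⟩

lemma moves (pop : Pop m) (O : Set (Fin m → ℕ)) (hO : FluctSet pop O) (x : Fin m → ℕ)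
    (hx : x ∈ O) : ∃ y, Step pop x y ∧ y ∈ O ∧ y ≠ x := by
  obtain ⟨⟨hinv, hmin⟩, u, hu, v, hv, huv⟩ := hO
  by_contra hc
  push Not at hc
  refine hmin {x} ?_ ⟨x, rfl⟩ ⟨?_, ?_⟩
  · rw [Set.ssubset_iff_subset_ne]
    refine ⟨by simpa using hx, ?_⟩
    rintro rfl
    exact huv (hu.trans hv.symm)
  · rintro _ rfl
    exact hinv.1 _ hx
  · rintro _ rfl y hy
    exact hc y hy (hinv.2 _ hx y hy)

lemma low_defect (pop : Pop m) (O : Set (Fin m → ℕ)) (hO : FluctSet pop O) (a : ℕ)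
    (hlo : ∀ x ∈ O, a ≤ nC x) (y : Fin m → ℕ) (hy : IsState pop y) (hya : nC y = a + 1)
    (hyc : ¬ coopMax pop y) (N : ℕ) :
    ∀ w ∈ O, nC w = a + 1 → ¬ coopMax pop w → ∑ i, (y i - w i) = N → y ∈ O := by
  induction N using Nat.strong_induction_on with
  | _ N ih =>
  intro w hw hwa hwc hN
  by_cases hyw : w = y
  · exact hyw ▸ hw
  obtain ⟨j0, hj0, hj0'⟩ := not_coop pop w hwc
  obtain ⟨j1, hj1, hj1'⟩ := not_coop pop y hyc
  -- choose surplus l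
  have hl : ∃ l, y l < w l ∧ (y j1 < w j1 → l = j1) := by
    by_cases h : y j1 < w j1
    · exact ⟨j1, h, fun _ => rfl⟩
    · obtain ⟨l, hl⟩ := ex_lt y w (by omega) (Ne.symm hyw)
      exact ⟨l, hl, fun h' => absurd h' h⟩
  have hj : ∃ j, w j < y j ∧ (j = j0 → ∀ i, w i < y i → i = j0) := by
    by_cases h : ∃ j, w j < y j ∧ j ≠ j0
    · obtain ⟨j, h1, h2⟩ := h
      exact ⟨j, h1, fun h3 => absurd h3 h2⟩
    · push Not at h
      obtain ⟨j, hj⟩ := ex_lt w y (by omega) hyw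
      exact ⟨j, hj, fun _ => h⟩
  obtain ⟨l, hl, hl1⟩ := hl
  obtain ⟨j, hj, hj2⟩ := hj
  have hlj : l ≠ j := by rintro rfl; omega
  have hinv := hO.1.1
  have hw1 := hinv.2 w hw _ (step_down pop w hwc l (by omega))
  have hn1 := nC_pred w l (by omega)
  set w1 := Function.update w l (w l - 1) with hw1def
  have hw1j : w1 j = w j := by simp [hw1def, hlj.symm]
  have hup : ¬ defMax pop w1 := by
    obtain ⟨v, hv, hvO, hvne⟩ := moves pop O hO w1 hw1
    have := hlo v hvO
    rcases step_cases pop w1 v hv with h | ⟨_, _, _, _, h⟩ | ⟨h, _⟩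
    · exact absurd h hvne
    · omega
    · exact h
  have hyj := hy j
  have hw2 := hinv.2 w1 hw1 _ (step_up pop w1 hup j (by omega))
  have hn2 := nC_succ w1 j
  set w2 := Function.update w1 j (w1 j + 1) with hw2def
  have hw2j : w2 j = w j + 1 := by simp [hw2def, hw1j]
  have hw2l : w2 l = w l - 1 := by simp [hw2def, hlj, hw1def]
  have hw2i : ∀ i, i ≠ j → i ≠ l → w2 i = w i := by
    intro i h1 h2
    simp [hw2def, h1, hw1def, h2]
  have hn2' : nC w2 = a + 1 := by omega
  by_cases hc : coopMax pop w2
  · obtain ⟨i, hi, -, hub⟩ := hc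
    rw [hn2'] at hub
    rw [hwa] at hj0'
    rw [hya] at hj1'
    unfold activeC at *
    unfold activeD at *
    by_cases hact : w2 j0 < pop.nvec j0
    · have h1 := hub j0 hact
      have hij : i = j := by
        by_contra hij
        have : 0 < w i := by
          by_cases hil : i = l
          · subst hil; omega
          · rw [hw2i i hij hil] at hi; exact hi
        exact absurd (hj0' i this) (not_lt.2 h1)
      subst hij
      have h2 := hj1' i (by omega)
      have h3 : w2 j1 < pop.nvec j1 := by
        by_cases h4 : j1 = i
        · subst h4; omega
        · by_cases h5 : j1 = l
          · subst h5
            have := hinv.1 w hw j1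
            omega
          · rw [hw2i j1 h4 h5]
            have : ¬ y j1 < w j1 := fun h => h5 (hl1 h).symm
            omega
      exact absurd h2 (not_lt.2 (hub j1 h3))
    · have hjj : j0 = j := by
        by_contra hne
        by_cases h5 : j0 = l
        · subst h5; omega
        · rw [hw2i j0 hne h5] at hact; omega
      subst hjj
      have : y = w2 := by
        refine eq_of_le_nC y w2 (fun i => ?_) (by omega)
        by_cases h4 : i = j0
        · subst h4; omega
        · by_cases h5 : i = l
          · subst h5; omega
          · rw [hw2i i h4 h5]
            by_contra h6
            exact h4 (hj2 rfl i (by omega))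
      rw [this]; exact hw2
  · refine ih (∑ i, (y i - w2 i)) ?_ w2 hw2 hn2' hc rfl
    rw [← hN]
    refine Finset.sum_lt_sum (fun i _ => ?_) ⟨j, Finset.mem_univ j, by omega⟩
    by_cases h4 : i = j
    · subst h4; omega
    · by_cases h5 : i = l
      · subst h5; omega
      · rw [hw2i i h4 h5]

lemma high_coop (pop : Pop m) (O : Set (Fin m → ℕ)) (hO : FluctSet pop O) (b : ℕ)
    (hhi : ∀ x ∈ O, nC x ≤ b) (y : Fin m → ℕ) (hy : IsState pop y) (hyb : nC y + 1 = b)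
    (hyc : ¬ defMax pop y) (N : ℕ) :
    ∀ w ∈ O, nC w + 1 = b → ¬ defMax pop w → ∑ i, (w i - y i) = N → y ∈ O := by
  induction N using Nat.strong_induction_on with
  | _ N ih =>
  intro w hw hwb hwc hN
  by_cases hyw : w = y
  · exact hyw ▸ hw
  obtain ⟨j0, hj0, hj0'⟩ := not_def pop w hwc
  obtain ⟨j1, hj1, hj1'⟩ := not_def pop y hyc
  have hl : ∃ l, w l < y l ∧ (w j1 < y j1 → l = j1) := by
    by_cases h : w j1 < y j1
    · exact ⟨j1, h, fun _ => rfl⟩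
    · obtain ⟨l, hl⟩ := ex_lt w y (by omega) hyw
      exact ⟨l, hl, fun h' => absurd h' h⟩
  have hj : ∃ j, y j < w j ∧ (j = j0 → ∀ i, y i < w i → i = j0) := by
    by_cases h : ∃ j, y j < w j ∧ j ≠ j0
    · obtain ⟨j, h1, h2⟩ := h
      exact ⟨j, h1, fun h3 => absurd h3 h2⟩
    · push Not at h
      obtain ⟨j, hj⟩ := ex_lt y w (by omega) (Ne.symm hyw)
      exact ⟨j, hj, fun _ => h⟩
  obtain ⟨l, hl, hl1⟩ := hl
  obtain ⟨j, hj, hj2⟩ := hj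
  have hlj : l ≠ j := by rintro rfl; omega
  have hinv := hO.1.1
  have hyl := hy l
  have hw1 := hinv.2 w hw _ (step_up pop w hwc l (by omega))
  have hn1 := nC_succ w l
  set w1 := Function.update w l (w l + 1) with hw1def
  have hw1j : w1 j = w j := by simp [hw1def, hlj.symm]
  have hup : ¬ coopMax pop w1 := by
    obtain ⟨v, hv, hvO, hvne⟩ := moves pop O hO w1 hw1
    have := hhi v hvO
    rcases step_cases pop w1 v hv with h | ⟨h, _⟩ | ⟨_, _, _, _, h⟩
    · exact absurd h hvne
    · exact h
    · omega
  have hw2 := hinv.2 w1 hw1 _ (step_down pop w1 hup j (by omega))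
  have hn2 := nC_pred w1 j (by omega)
  set w2 := Function.update w1 j (w1 j - 1) with hw2def
  have hw2j : w2 j = w j - 1 := by simp [hw2def, hw1j]
  have hw2l : w2 l = w l + 1 := by simp [hw2def, hlj, hw1def]
  have hw2i : ∀ i, i ≠ j → i ≠ l → w2 i = w i := by
    intro i h1 h2
    simp [hw2def, h1, hw1def, h2]
  have hn2' : nC w2 = nC w := by omega
  have hwj := hinv.1 w hw j
  by_cases hc : defMax pop w2
  · obtain ⟨i, hi, hub, -⟩ := hc
    have hyw' : nC y = nC w := by omega
    rw [hn2'] at hub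
    rw [hyw'] at hj1'
    unfold activeC at *
    unfold activeD at *
    by_cases hact : 0 < w2 j0
    · have h1 := hub j0 hact
      have hij : i = j := by
        by_contra hij
        have : w i < pop.nvec i := by
          by_cases hil : i = l
          · subst hil; omega
          · rw [hw2i i hij hil] at hi; exact hi
        exact absurd (hj0' i this) (not_lt.2 h1)
      subst hij
      have h2 := hj1' i (by omega)
      have h3 : 0 < w2 j1 := by
        by_cases h4 : j1 = i
        · subst h4; omega
        · by_cases h5 : j1 = l
          · subst h5; omega
          · rw [hw2i j1 h4 h5]
            have : ¬ w j1 < y j1 := fun h => h5 (hl1 h).symm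
            omega
      exact absurd h2 (not_lt.2 (hub j1 h3))
    · have hjj : j0 = j := by
        by_contra hne
        by_cases h5 : j0 = l
        · subst h5; omega
        · rw [hw2i j0 hne h5] at hact; omega
      subst hjj
      have : w2 = y := by
        refine eq_of_le_nC w2 y (fun i => ?_) (by omega)
        by_cases h4 : i = j0
        · subst h4; omega
        · by_cases h5 : i = l
          · subst h5; omega
          · rw [hw2i i h4 h5]
            by_contra h6
            exact h4 (hj2 rfl i (by omega))
      rw [← this]; exact hw2
  · refine ih (∑ i, (w2 i - y i)) ?_ w2 hw2 (by omega) hc rfl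
    rw [← hN]
    refine Finset.sum_lt_sum (fun i _ => ?_) ⟨j, Finset.mem_univ j, by omega⟩
    by_cases h4 : i = j
    · subst h4; omega
    · by_cases h5 : i = l
      · subst h5; omega
      · rw [hw2i i h4 h5]

lemma step_state (pop : Pop m) (x y : Fin m → ℕ) (hx : IsState pop x) (h : Step pop x y) :
    IsState pop y := by
  intro k
  have hk := hx k
  rcases step_cases pop x y h with rfl | ⟨_, i, hi, rfl, _⟩ | ⟨_, i, hi, rfl, _⟩
  · exact hk
  · by_cases hki : k = i
    · subst hki; simp; omega
    · simpa [hki] using hk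
  · by_cases hki : k = i
    · subst hki; simp; omega
    · simpa [hki] using hk

lemma ex_pos (x : Fin m → ℕ) (h : 1 ≤ nC x) : ∃ i, 0 < x i := by
  by_contra hc
  push Not at hc
  have : nC x = 0 := Finset.sum_eq_zero (fun i _ => by have := hc i; omega)
  omega

lemma ex_lt_n (pop : Pop m) (x : Fin m → ℕ) (h : nC x < nTot pop) : ∃ i, x i < pop.nvec i := by
  by_contra hc
  push Not at hc
  have : nTot pop ≤ nC x := Finset.sum_le_sum (fun i _ => hc i)
  omega

/-- every trajectory starting with a number of cooperators in
`[a+1, b-1]` keeps its number of cooperators in the fluctuation interval `[a, b]`. -/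
theorem stmt7 (pop : Pop m) (O : Set (Fin m → ℕ)) (a b : ℕ)
    (ha : 1 ≤ a) (ha' : a ≤ nTot pop - 1) (hb : 1 ≤ b) (hb' : b ≤ nTot pop - 1)
    (hO : FluctInterval pop O a b)
    (X : ℕ → Fin m → ℕ) (hX : Traj pop X)
    (h0 : a + 1 ≤ nC (X 0) ∧ nC (X 0) ≤ b - 1) :
    ∀ t, a ≤ nC (X t) ∧ nC (X t) ≤ b := by
  obtain ⟨hF, ⟨xa, hxa, hxa'⟩, hlo, ⟨xb, hxb, hxb'⟩, hhi⟩ := hO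
  have hinv := hF.1.1
  have hmin := hF.1.2
  -- down-going member of `O` at level `a + 1`
  obtain ⟨w, hw, hwa, hwc⟩ : ∃ w ∈ O, nC w = a + 1 ∧ ¬ coopMax pop w := by
    by_contra hc
    push Not at hc
    refine hmin {x | x ∈ O ∧ a + 1 ≤ nC x} ?_ ⟨xb, hxb, by omega⟩ ⟨fun x hx => hinv.1 x hx.1, ?_⟩
    · rw [Set.ssubset_iff_of_subset (fun x hx => hx.1)]
      refine ⟨xa, hxa, fun h => ?_⟩
      have := h.2
      omega
    · rintro x ⟨hx, hxl⟩ y hy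
      refine ⟨hinv.2 x hx y hy, ?_⟩
      rcases step_cases pop x y hy with rfl | ⟨h, _, _, _, h'⟩ | ⟨_, _, _, _, h'⟩
      · exact hxl
      · by_contra hlt
        exact h (hc x hx (by omega))
      · omega
  obtain ⟨v, hv, hvb, hvc⟩ : ∃ v ∈ O, nC v + 1 = b ∧ ¬ defMax pop v := by
    by_contra hc
    push Not at hc
    refine hmin {x | x ∈ O ∧ nC x + 1 ≤ b} ?_ ⟨xa, hxa, by omega⟩ ⟨fun x hx => hinv.1 x hx.1, ?_⟩
    · rw [Set.ssubset_iff_of_subset (fun x hx => hx.1)]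
      refine ⟨xb, hxb, fun h => ?_⟩
      have := h.2
      omega
    · rintro x ⟨hx, hxl⟩ y hy
      refine ⟨hinv.2 x hx y hy, ?_⟩
      rcases step_cases pop x y hy with rfl | ⟨_, _, _, _, h'⟩ | ⟨h, _, _, _, h'⟩
      · exact hxl
      · omega
      · by_contra hlt
        exact h (hc x hx (by omega))
  have key : ∀ t, IsState pop (X t) ∧ a ≤ nC (X t) ∧ nC (X t) ≤ b ∧
      (nC (X t) = a → coopMax pop (X t)) ∧ (nC (X t) = b → defMax pop (X t)) := by
    intro t
    induction t with
    | zero => exact ⟨hX.1, by omega, by omega, fun h => by omega, fun h => by omega⟩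
    | succ t ih =>
      obtain ⟨hs, h1, h2, h3, h4⟩ := ih
      have hst := hX.2 t
      have hs' := step_state pop _ _ hs hst
      rcases step_cases pop _ _ hst with h | ⟨h, i, _, _, h'⟩ | ⟨h, i, _, _, h'⟩
      · rw [h]; exact ⟨hs, h1, h2, h3, h4⟩
      · have hne : nC (X t) ≠ a := fun e => h (h3 e)
        refine ⟨hs', by omega, by omega, fun e => ?_, fun e => by omega⟩
        by_contra hcm
        have hyO : X t ∈ O :=
          low_defect pop O hF a hlo (X t) hs (by omega) h _ w hw hwa hwc rfl
        have hzO := hinv.2 _ hyO _ hst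
        obtain ⟨k, hk⟩ := ex_pos (X (t + 1)) (by omega)
        have := hlo _ (hinv.2 _ hzO _ (step_down pop _ hcm k hk))
        have := nC_pred _ k hk
        omega
      · have hne : nC (X t) ≠ b := fun e => h (h4 e)
        refine ⟨hs', by omega, by omega, fun e => by omega, fun e => ?_⟩
        by_contra hcm
        have hyO : X t ∈ O :=
          high_coop pop O hF b hhi (X t) hs (by omega) h _ v hv hvb hvc rfl
        have hzO := hinv.2 _ hyO _ hst
        obtain ⟨k, hk⟩ := ex_lt_n pop (X (t + 1)) (by omega)
        have := hhi _ (hinv.2 _ hzO _ (step_up pop _ hcm k hk))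
        have := nC_succ (X (t + 1)) k
        omega
  exact fun t => ⟨(key t).2.1, (key t).2.2.1⟩
end
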